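/- The family gamma -> (0 - gamma omega)/(0 - gamma(alpha omega)) = (gamma omega)/(gamma(alpha omega)), indexed by gamma in Gamma, is multipliable, and its product u_alpha(0) satisfies |u_alpha(0) - pi| < 2^{-5}, where pi = 1/T. (Part of Proposition 8.1 of the paper.) -/

import Mathlib

open Polynomial Matrix
open scoped Classical

/-- The absolute value on `K_∞ = F₂((π))`: `|x| = 2^{-v_∞(x)}`. -/
noncomputable def absK2 (x : LaurentSeries (ZMod 2)) : ℝ :=
  if x = 0 then 0 else (2 : ℝ) ^ (-(HahnSeries.order x))

/-- The element `T = π⁻¹` of `K_∞ = F₂((π))`. -/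
noncomputable def Tel2 : LaurentSeries (ZMod 2) :=
  HahnSeries.single (-1 : ℤ) 1

/-- The embedding `A = F₂[T] → C`, sending `T` to `π⁻¹`. -/
noncomputable def polyEmb2 (C : Type*) [NormedField C]
    [Algebra (LaurentSeries (ZMod 2)) C] : Polynomial (ZMod 2) →+* C :=
  (algebraMap (LaurentSeries (ZMod 2)) C).comp (Polynomial.aeval Tel2).toRingHom

/-- The action of a matrix over `A = F₂[T]` on `C` by fractional linear
transformations. -/
noncomputable def act2 {C : Type*} [NormedField C] [Algebra (LaurentSeries (ZMod 2)) C]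
    (g : Matrix (Fin 2) (Fin 2) (Polynomial (ZMod 2))) (z : C) : C :=
  (polyEmb2 C (g 0 0) * z + polyEmb2 C (g 0 1)) /
    (polyEmb2 C (g 1 0) * z + polyEmb2 C (g 1 1))

/-- `Γ = Γ₀(T³) = {[[a,b],[c,d]] : a,b,c,d ∈ F₂[T], ad - bc = 1, T³ ∣ c}`. -/
def Gamma0T3 : Set (Matrix (Fin 2) (Fin 2) (Polynomial (ZMod 2))) :=
  {g | g.det = 1 ∧ (Polynomial.X : Polynomial (ZMod 2)) ^ 3 ∣ g 1 0}

/-- The matrix `α = [[T²+T+1, 1],[T³, 1+T]] ∈ Γ₀(T³)`. -/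
noncomputable def alpha2 : Matrix (Fin 2) (Fin 2) (Polynomial (ZMod 2)) :=
  !![Polynomial.X ^ 2 + Polynomial.X + 1, 1; Polynomial.X ^ 3, 1 + Polynomial.X]

/-- The polynomial over `F₂` whose coefficients are the binary digits of `n`. -/
noncomputable def bitPoly (n : ℕ) : (ZMod 2)[X] :=
  ∑ i ∈ Finset.range n, if n.testBit i then X ^ i else 0

theorem coeff_sum_testBit {n k : ℕ} (h : n < 2 ^ k) (i : ℕ) :
    (∑ j ∈ Finset.range k, if n.testBit j then (X : (ZMod 2)[X]) ^ j else 0).coeff i =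
      if n.testBit i then 1 else 0 := by
  have h2 : ∀ j, (if n.testBit j then (X : (ZMod 2)[X]) ^ j else 0).coeff i =
      if i = j then (if n.testBit i then 1 else 0) else 0 := by
    intro j
    by_cases hij : i = j
    · subst hij
      cases n.testBit i <;> simp
    · cases n.testBit j <;> simp [coeff_X_pow, hij]
  rw [finsetSum_coeff, Finset.sum_congr rfl fun j _ => h2 j, Finset.sum_ite_eq]
  split_ifs with h1 h3 h3 <;> try rfl
  rw [Nat.testBit_lt_two_pow (h.trans_le (Nat.pow_le_pow_right two_pos
    (not_lt.1 fun h => h1 (Finset.mem_range.2 h))))] at h3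
  simp at h3

theorem coeff_bitPoly (n i : ℕ) : (bitPoly n).coeff i = if n.testBit i then 1 else 0 :=
  coeff_sum_testBit Nat.lt_two_pow_self i

theorem bitPoly_injective : Function.Injective bitPoly := by
  intro m n h
  refine Nat.eq_of_testBit_eq fun i => ?_
  have := congrArg (fun p => coeff p i) h
  simp only [coeff_bitPoly] at this
  cases hm : m.testBit i <;> cases hn : n.testBit i <;> simp_all

theorem bitPoly_xor (m n : ℕ) : bitPoly (m ^^^ n) = bitPoly m + bitPoly n := by
  ext i
  simp only [coeff_add, coeff_bitPoly, Nat.testBit_xor]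
  cases m.testBit i <;> cases n.testBit i <;> simp
  decide

@[simp] theorem bitPoly_zero : bitPoly 0 = 0 := by simp [bitPoly]

@[simp] theorem bitPoly_one : bitPoly 1 = 1 := by simp [bitPoly]

theorem bitPoly_two_pow (k : ℕ) : bitPoly (2 ^ k) = X ^ k := by
  ext i
  simp [coeff_bitPoly, coeff_X_pow, Nat.testBit_two_pow, eq_comm]

theorem bitPoly_two_pow_mul (k n : ℕ) : bitPoly (2 ^ k * n) = X ^ k * bitPoly n := by
  ext i
  rw [coeff_bitPoly, coeff_X_pow_mul', coeff_bitPoly, Nat.testBit_two_pow_mul]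
  by_cases h : k ≤ i <;> simp [h]

theorem bitPoly_surjective : Function.Surjective bitPoly := by
  intro p
  induction p using Polynomial.induction_on' with
  | add p q hp hq =>
    obtain ⟨m, rfl⟩ := hp
    obtain ⟨n, rfl⟩ := hq
    exact ⟨m ^^^ n, bitPoly_xor m n⟩
  | monomial k a =>
    fin_cases a
    · exact ⟨0, bitPoly_zero.trans (monomial_zero_right k).symm⟩
    · exact ⟨2 ^ k, by rw [bitPoly_two_pow, X_pow_eq_monomial]; rfl⟩

theorem bitPoly_eq_sum {n k : ℕ} (h : n < 2 ^ k) :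
    bitPoly n = ∑ i ∈ Finset.range k, bitPoly (n >>> i % 2) * X ^ i := by
  have h' : ∀ j, bitPoly (n >>> j % 2) * X ^ j =
      if n.testBit j then (X : (ZMod 2)[X]) ^ j else 0 := by
    intro j
    rw [Nat.testBit_eq_decide_div_mod_eq, Nat.shiftRight_eq_div_pow]
    rcases Nat.mod_two_eq_zero_or_one (n / 2 ^ j) with hj | hj <;> simp [hj]
  rw [Finset.sum_congr rfl fun j _ => h' j]
  ext i
  rw [coeff_bitPoly, coeff_sum_testBit h]

theorem bitPoly_eq_mod_two_add (n : ℕ) : bitPoly n = bitPoly (n % 2) + X * bitPoly (n / 2) := by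
  have h := bitPoly_two_pow_mul 1 (n / 2)
  rw [pow_one, pow_one] at h
  rw [← h, ← bitPoly_xor]
  congr 1
  refine Nat.eq_of_testBit_eq fun i => ?_
  cases i with
  | zero => simp [Nat.testBit_zero]
  | succ i =>
    rw [Nat.testBit_xor, Nat.testBit_lt_two_pow (x := n % 2), ← pow_one 2, Nat.testBit_two_pow_mul]
    · simp [Nat.testBit_succ]
    · exact (Nat.mod_lt _ two_pos).trans_le (by
        rw [pow_succ]
        have := Nat.one_le_two_pow (n := i)
        omega)

/-- Apply `f` to `n`, making the kernel evaluate `n` first. -/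
def force {α : Type} (n : ℕ) (f : ℕ → α) : α :=
  Nat.rec (f 0) (fun k _ => f (k + 1)) n

@[simp] theorem force_eq {α : Type} (n : ℕ) (f : ℕ → α) : force n f = f n := by
  cases n <;> rfl

/-- Carry-less multiplication: the product of `F₂[T]` on binary codes. -/
def clmul (x y : ℕ) : ℕ :=
  force x fun x => force y fun y =>
    Nat.rec 0 (fun i r => r ^^^ ((y >>> i % 2 * x) <<< i)) (y.log2 + 1)

@[simp] theorem bitPoly_clmul (x y : ℕ) : bitPoly (clmul x y) = bitPoly x * bitPoly y := by
  have key : ∀ k, bitPoly (Nat.rec 0 (fun i r => r ^^^ ((y >>> i % 2 * x) <<< i)) k : ℕ) =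
      bitPoly x * ∑ i ∈ Finset.range k, bitPoly (y >>> i % 2) * X ^ i := by
    intro k
    induction k with
    | zero => simp
    | succ k ih =>
      rw [Finset.sum_range_succ, mul_add, ← ih, bitPoly_xor, Nat.shiftLeft_eq, mul_comm _ (2 ^ k),
        bitPoly_two_pow_mul]
      rcases Nat.mod_two_eq_zero_or_one (y >>> k) with hj | hj <;> simp [hj, mul_comm]
  rw [clmul, force_eq, force_eq]
  exact (key _).trans (by rw [← bitPoly_eq_sum Nat.lt_log2_self])

/-- Multiplication in `F₂[T][ρ]`, `ρ² = ρ + 1`, on pairs of binary codes. -/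
def quadMul (p q : ℕ × ℕ) : ℕ × ℕ :=
  Prod.rec (fun a b => Prod.rec (fun c d =>
    force (clmul b d) fun e =>
      force (clmul a c ^^^ e) fun u =>
        force (clmul a d ^^^ clmul b c ^^^ e) fun v => (u, v)) q) p

/-- The product of `t 0, …, t (n - 1)` for `quadMul`. -/
def quadProd (t : ℕ → ℕ × ℕ) (n : ℕ) : ℕ × ℕ :=
  Nat.rec (1, 0) (fun i r => quadMul r (t i)) n

/-- The only code `d < 256` for which `a * d = 1 + b * c` may hold, when `a` is odd. -/
def solveDet (a b c : ℕ) : ℕ :=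
  force (clmul a a) fun e =>
    clmul (clmul (1 ^^^ clmul b c) a) (clmul e (clmul e e)) % 256

/-- The code of `a (T³ + T) + b (T⁴ + T³ + T²)`. -/
def lowerCode (a b : ℕ) : ℕ := clmul a 10 ^^^ clmul b 28

/-- Whether `solveDet` completes `(a, b)`, `c` to a matrix of determinant one. -/
def detOne (a b c d : ℕ) : Bool := Nat.beq (clmul a d) (1 ^^^ clmul b c)

/-- The numerator of the factor attached to a matrix. -/
def numCode (a b c d : ℕ) : ℕ × ℕ := quadMul (lowerCode c d, c) (4 * b, a)

/-- The denominator of the factor attached to a matrix. -/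
def denCode (a b c d : ℕ) : ℕ × ℕ := quadMul (4 * d, c) (lowerCode a b, a)

/-- The product of `t a b c d` over the matrices of determinant one in a search box. -/
def boxProd (t : ℕ → ℕ → ℕ → ℕ → ℕ × ℕ) : ℕ × ℕ :=
  quadProd (fun i => quadProd (fun b => force (2 * i + 1) fun a =>
    quadProd (fun j => force (8 * j) fun c => force (solveDet a b c) fun d =>
      bif detOne a b c d then t a b c d else (1, 0))
      (128 / 2 ^ (max a (lowerCode a b)).log2)) 128) 128

/-- A test on codes for `|T p - q| ≤ 2⁻⁵ |q|` in `F₂[T][ρ]`. -/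
def closeTest (p q : ℕ × ℕ) : Bool :=
  Prod.rec (fun x y => Prod.rec (fun u v =>
    Nat.ble ((max (2 * x ^^^ u) (2 * y ^^^ v)).log2 + 5) (max u v).log2) q) p

theorem two_eq_zero {C : Type*} [NormedField C] (e : (ZMod 2)[X] →+* C) : (2 : C) = 0 := by
  have h : (2 : (ZMod 2)[X]) = 0 := CharTwo.two_eq_zero
  rw [← map_ofNat e 2, h, map_zero]

theorem norm_root {C : Type*} [NormedField C] {ρ : C} (hρ : ρ ^ 2 + ρ + 1 = 0) :
    ‖ρ‖ = 1 ∧ ‖ρ + 1‖ = 1 := by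
  have h3 : ρ ^ 3 = 1 := by linear_combination (ρ - 1) * hρ
  have h1 : ‖ρ‖ = 1 := by
    have : ‖ρ‖ ^ 3 = 1 := by rw [← norm_pow, h3, norm_one]
    exact (pow_eq_one_iff_of_nonneg (norm_nonneg _) three_ne_zero).1 this
  refine ⟨h1, ?_⟩
  rw [show ρ + 1 = -(ρ ^ 2) by linear_combination hρ, norm_neg, norm_pow, h1, one_pow]

section Ultrametric

variable {C : Type*} [NormedField C] [IsUltrametricDist C] {ι : Type*}

theorem norm_prod_sub_one_le {f : ι → C} {δ : ℝ} (h0 : 0 ≤ δ) (h1 : δ ≤ 1) (s : Finset ι)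
    (h : ∀ i ∈ s, ‖f i - 1‖ ≤ δ) : ‖∏ i ∈ s, f i - 1‖ ≤ δ := by
  induction s using Finset.induction_on with
  | empty => simpa using h0
  | insert a s ha ih =>
    have ha' := h a (Finset.mem_insert_self a s)
    have hs := ih fun i hi => h i (Finset.mem_insert_of_mem hi)
    have hfa : ‖f a‖ ≤ 1 := by
      have := IsUltrametricDist.norm_add_le_max (f a - 1) 1
      rw [sub_add_cancel, norm_one] at this
      exact this.trans (max_le (ha'.trans h1) le_rfl)
    rw [Finset.prod_insert ha, show f a * ∏ i ∈ s, f i - 1 =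
      f a * (∏ i ∈ s, f i - 1) + (f a - 1) by ring]
    refine (IsUltrametricDist.norm_add_le_max _ _).trans (max_le ?_ ha')
    rw [norm_mul]
    exact (mul_le_of_le_one_left (norm_nonneg _) hfa).trans hs

theorem norm_prod_sub_prod_le {f : ι → C} {δ : ℝ} (h0 : 0 ≤ δ) (h1 : δ ≤ 1) {s t : Finset ι}
    (hst : s ⊆ t) (h : ∀ i ∉ s, ‖f i - 1‖ ≤ δ) :
    ‖∏ i ∈ t, f i - ∏ i ∈ s, f i‖ ≤ δ * ‖∏ i ∈ s, f i‖ := by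
  rw [← Finset.prod_sdiff hst, ← sub_one_mul, norm_mul]
  exact mul_le_mul_of_nonneg_right (norm_prod_sub_one_le h0 h1 _ fun i hi =>
    h i (Finset.mem_sdiff.1 hi).2) (norm_nonneg _)

theorem multipliable_of_finite_le_norm_sub_one [CompleteSpace C] {f : ι → C}
    (h : ∀ ε > 0, {i | ε ≤ ‖f i - 1‖}.Finite) : Multipliable f := by
  have hout : ∀ ε > 0, ∀ s : Finset ι, {i | ε ≤ ‖f i - 1‖} ⊆ s → ∀ i ∉ s, ‖f i - 1‖ ≤ ε :=
    fun ε _ s hs i hi => (not_le.1 fun hle => hi (hs hle)).le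
  set s₀ := (h 1 one_pos).toFinset with hs₀
  have hs₀' : ∀ i ∉ s₀, ‖f i - 1‖ ≤ 1 := hout 1 one_pos s₀ (by simp [hs₀])
  have hbound : ∀ t, s₀ ⊆ t → ‖∏ i ∈ t, f i‖ ≤ ‖∏ i ∈ s₀, f i‖ := by
    intro t ht
    have := IsUltrametricDist.norm_add_le_max (∏ i ∈ t, f i - ∏ i ∈ s₀, f i) (∏ i ∈ s₀, f i)
    rw [sub_add_cancel] at this
    refine this.trans (max_le ?_ le_rfl)
    simpa using norm_prod_sub_prod_le zero_le_one le_rfl ht hs₀'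
  have hC : CauchySeq fun s : Finset ι => ∏ i ∈ s, f i := by
    refine Metric.cauchySeq_iff'.2 fun ε hε => ?_
    set M := ‖∏ i ∈ s₀, f i‖ with hM
    have hM0 : 0 ≤ M := norm_nonneg _
    have hδ : 0 < min 1 (ε / (M + 1)) := by positivity
    refine ⟨s₀ ∪ (h _ hδ).toFinset, fun t ht => ?_⟩
    rw [dist_eq_norm]
    have h1 := norm_prod_sub_prod_le hδ.le (min_le_left _ _) ht
      (hout _ hδ _ fun i hi => by simpa using Or.inr hi)
    have h2 := hbound (s₀ ∪ (h _ hδ).toFinset) Finset.subset_union_left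
    calc _ ≤ _ := h1
      _ ≤ ε / (M + 1) * M := mul_le_mul (min_le_right _ _) h2 (norm_nonneg _) (by positivity)
      _ < ε := by
        rw [div_mul_eq_mul_div, div_lt_iff₀ (by positivity)]
        nlinarith
  obtain ⟨a, ha⟩ := cauchySeq_tendsto_of_complete hC
  exact ⟨a, by simpa [HasProd] using ha⟩

theorem norm_tprod_sub_prod_le {f : ι → C} (hf : Multipliable f) {δ : ℝ} (h0 : 0 ≤ δ) (h1 : δ ≤ 1)
    (s : Finset ι) (h : ∀ i ∉ s, ‖f i - 1‖ ≤ δ) :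
    ‖∏' i, f i - ∏ i ∈ s, f i‖ ≤ δ * ‖∏ i ∈ s, f i‖ := by
  have ht : Filter.Tendsto (fun t : Finset ι => ∏ i ∈ t, f i) Filter.atTop (nhds (∏' i, f i)) := by
    simpa [HasProd] using hf.hasProd
  refine le_of_tendsto (ht.sub_const _).norm ?_
  filter_upwards [Filter.eventually_ge_atTop s] with t hst
  exact norm_prod_sub_prod_le h0 h1 hst h

end Ultrametric

section Eval

variable {C : Type*} [NormedField C] {e : (ZMod 2)[X] →+* C}

/-- The element of `F₂[T][ρ]` with code `x`. -/
noncomputable def quadEval (e : (ZMod 2)[X] →+* C) (ρ : C) (x : ℕ × ℕ) : C :=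
  e (bitPoly x.1) + e (bitPoly x.2) * ρ

theorem quadEval_quadMul {ρ : C} (hρ : ρ ^ 2 + ρ + 1 = 0) (x y : ℕ × ℕ) :
    quadEval e ρ (quadMul x y) = quadEval e ρ x * quadEval e ρ y := by
  obtain ⟨a, b⟩ := x
  obtain ⟨c, d⟩ := y
  simp only [quadMul, quadEval, force_eq, bitPoly_xor, bitPoly_clmul, map_add, map_mul]
  linear_combination (-e (bitPoly b) * e (bitPoly d)) * hρ +
    (e (bitPoly b) * e (bitPoly d)) * (ρ + 1) * two_eq_zero e

theorem quadEval_quadProd {ρ : C} (hρ : ρ ^ 2 + ρ + 1 = 0) (t : ℕ → ℕ × ℕ) (n : ℕ) :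
    quadEval e ρ (quadProd t n) = ∏ i ∈ Finset.range n, quadEval e ρ (t i) := by
  induction n with
  | zero => simp [quadProd, quadEval]
  | succ n ih =>
    rw [Finset.prod_range_succ, ← ih, ← quadEval_quadMul hρ]
    rfl

end Eval

section Norm

variable {C : Type*} [NormedField C] [IsUltrametricDist C] {e : (ZMod 2)[X] →+* C}

theorem norm_bitPoly (hX : ‖e X‖ = 2) {n : ℕ} (hn : n ≠ 0) : ‖e (bitPoly n)‖ = 2 ^ n.log2 := by
  induction n using Nat.strong_induction_on with
  | _ n ih =>
    rcases Nat.lt_or_ge n 2 with h | h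
    · obtain rfl : n = 1 := by omega
      simp [Nat.log2_def]
    · have h2 := ih (n / 2) (by omega) (by omega)
      have hlog : n.log2 = (n / 2).log2 + 1 := by rw [Nat.log2_def, if_pos h]
      have hr : ‖e (bitPoly (n % 2))‖ ≤ 1 := by
        rcases Nat.mod_two_eq_zero_or_one n with hj | hj <;> simp [hj]
      have hq : ‖e (X * bitPoly (n / 2))‖ = 2 ^ n.log2 := by
        rw [map_mul, norm_mul, hX, h2, hlog, pow_succ']
      have : (1 : ℝ) < 2 ^ n.log2 := one_lt_pow₀ one_lt_two (by omega)
      rw [bitPoly_eq_mod_two_add, map_add, IsUltrametricDist.norm_add_eq_max_of_norm_ne_norm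
        (by rw [hq]; linarith), hq, max_eq_right (by linarith)]

theorem norm_bitPoly_mono (hX : ‖e X‖ = 2) {m n : ℕ} (h : m ≤ n) :
    ‖e (bitPoly m)‖ ≤ ‖e (bitPoly n)‖ := by
  rcases eq_or_ne m 0 with rfl | hm
  · simp
  · rw [norm_bitPoly hX hm, norm_bitPoly hX (by omega)]
    refine pow_le_pow_right₀ one_le_two ?_
    rw [Nat.log2_eq_log_two, Nat.log2_eq_log_two]
    exact Nat.log_mono_right h

theorem one_le_norm (hX : ‖e X‖ = 2) {p : (ZMod 2)[X]} (hp : p ≠ 0) : 1 ≤ ‖e p‖ := by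
  obtain ⟨n, rfl⟩ := bitPoly_surjective p
  rw [norm_bitPoly hX (by rintro rfl; simp at hp)]
  exact one_le_pow₀ one_le_two

theorem lt_two_pow_of_norm_bitPoly_lt (hX : ‖e X‖ = 2) {n k : ℕ}
    (h : ‖e (bitPoly n)‖ < 2 ^ k) : n < 2 ^ k := by
  rcases eq_or_ne n 0 with rfl | hn
  · positivity
  · rw [norm_bitPoly hX hn, pow_lt_pow_iff_right₀ one_lt_two] at h
    exact (Nat.log2_lt hn).1 h

theorem norm_bitPoly_add_lt (hX : ‖e X‖ = 2) {m n : ℕ} (hm : m ≠ 0) (hn : n ≠ 0)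
    (h : ‖e (bitPoly m)‖ = ‖e (bitPoly n)‖) : ‖e (bitPoly m + bitPoly n)‖ < ‖e (bitPoly n)‖ := by
  rw [← bitPoly_xor, norm_bitPoly hX hn]
  rw [norm_bitPoly hX hm, norm_bitPoly hX hn, pow_right_inj₀ two_pos (by norm_num)] at h
  rcases eq_or_ne (m ^^^ n) 0 with h0 | h0
  · simp [h0]
  · rw [norm_bitPoly hX h0, pow_lt_pow_iff_right₀ one_lt_two, Nat.log2_lt h0]
    refine Nat.lt_pow_two_of_testBit _ fun i hi => ?_
    rw [Nat.testBit_xor]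
    rcases hi.eq_or_lt with rfl | hi
    · rw [Nat.testBit_log2 hn, ← h, Nat.testBit_log2 hm]; rfl
    · rw [Nat.testBit_lt_two_pow ((Nat.log2_lt hn).1 hi),
        Nat.testBit_lt_two_pow ((Nat.log2_lt hm).1 (h ▸ hi))]
      rfl

theorem norm_add_mul_root (hX : ‖e X‖ = 2) {ρ : C} (hρ : ρ ^ 2 + ρ + 1 = 0) (p q : (ZMod 2)[X]) :
    ‖e p + e q * ρ‖ = max ‖e p‖ ‖e q‖ := by
  have hq : ‖e q * ρ‖ = ‖e q‖ := by rw [norm_mul, (norm_root hρ).1, mul_one]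
  by_cases h : ‖e p‖ = ‖e q‖
  · rcases eq_or_ne q 0 with rfl | hq0
    · simp
    · have hp0 : p ≠ 0 := by
        rintro rfl
        have := one_le_norm hX hq0
        rw [← h] at this
        norm_num at this
      obtain ⟨m, rfl⟩ := bitPoly_surjective p
      obtain ⟨n, rfl⟩ := bitPoly_surjective q
      have hlt := norm_bitPoly_add_lt hX (by rintro rfl; simp at hp0) (by rintro rfl; simp at hq0) h
      have h1 : ‖e (bitPoly n) * (ρ + 1)‖ = ‖e (bitPoly n)‖ := by
        rw [norm_mul, (norm_root hρ).2, mul_one]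
      rw [show e (bitPoly m) + e (bitPoly n) * ρ =
        e (bitPoly m + bitPoly n) + e (bitPoly n) * (ρ + 1) by
          rw [map_add]; linear_combination (-e (bitPoly n)) * two_eq_zero e,
        IsUltrametricDist.norm_add_eq_max_of_norm_ne_norm (by rw [h1]; exact hlt.ne), h1, h,
        max_self, max_eq_right hlt.le]
  · rw [IsUltrametricDist.norm_add_eq_max_of_norm_ne_norm (by rwa [hq]), hq]

theorem norm_quadEval (hX : ‖e X‖ = 2) {ρ : C} (hρ : ρ ^ 2 + ρ + 1 = 0) (x : ℕ × ℕ) :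
    ‖quadEval e ρ x‖ = ‖e (bitPoly (max x.1 x.2))‖ := by
  rw [quadEval, norm_add_mul_root hX hρ]
  rcases le_total x.1 x.2 with h | h
  · rw [max_eq_right h, max_eq_right (norm_bitPoly_mono hX h)]
  · rw [max_eq_left h, max_eq_left (norm_bitPoly_mono hX h)]

end Norm

section Factor

variable {C : Type*} [NormedField C] {e : (ZMod 2)[X] →+* C} {ρ : C}

/-- `a (T³ + T) + b (T⁴ + T³ + T²)`, the rational part of the numerator of `γ (α ω)` when
`γ` has first row `(a, b)`. -/
noncomputable def lowerPoly (a b : (ZMod 2)[X]) : (ZMod 2)[X] :=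
  a * (X ^ 3 + X) + b * (X ^ 4 + X ^ 3 + X ^ 2)

theorem bitPoly_ten : bitPoly 10 = X ^ 3 + X := by
  rw [show 10 = 2 ^ 3 ^^^ 2 ^ 1 by decide, bitPoly_xor, bitPoly_two_pow, bitPoly_two_pow, pow_one]

theorem bitPoly_twentyEight : bitPoly 28 = X ^ 4 + X ^ 3 + X ^ 2 := by
  rw [show 28 = 2 ^ 4 ^^^ 2 ^ 3 ^^^ 2 ^ 2 by decide]
  simp only [bitPoly_xor, bitPoly_two_pow]

theorem bitPoly_lowerCode (a b : ℕ) :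
    bitPoly (lowerCode a b) = lowerPoly (bitPoly a) (bitPoly b) := by
  rw [lowerCode, lowerPoly, bitPoly_xor, bitPoly_clmul, bitPoly_clmul,
    bitPoly_ten, bitPoly_twentyEight]

/-- The numerator of the factor of `u_α(0)` attached to `g`. -/
noncomputable def factorNum (e : (ZMod 2)[X] →+* C) (ρ : C)
    (g : Matrix (Fin 2) (Fin 2) (ZMod 2)[X]) : C :=
  (e (lowerPoly (g 1 0) (g 1 1)) + e (g 1 0) * ρ) * (e (g 0 1 * X ^ 2) + e (g 0 0) * ρ)

/-- The denominator of `g ω`, times `T²`. -/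
noncomputable def factorDenom₁ (e : (ZMod 2)[X] →+* C) (ρ : C)
    (g : Matrix (Fin 2) (Fin 2) (ZMod 2)[X]) : C :=
  e (g 1 1 * X ^ 2) + e (g 1 0) * ρ

/-- The numerator of `g (α ω)`, times `T⁴ + T³ + T²`. -/
noncomputable def factorDenom₂ (e : (ZMod 2)[X] →+* C) (ρ : C)
    (g : Matrix (Fin 2) (Fin 2) (ZMod 2)[X]) : C :=
  e (lowerPoly (g 0 0) (g 0 1)) + e (g 0 0) * ρ

theorem ne_zero_of_mem_Gamma0T3 {g : Matrix (Fin 2) (Fin 2) (ZMod 2)[X]} (hg : g ∈ Gamma0T3) :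
    g 0 0 ≠ 0 ∧ g 1 1 ≠ 0 := by
  obtain ⟨hdet, hc⟩ := hg
  rw [det_fin_two] at hdet
  have hXc : X ∣ g 1 0 := (dvd_pow_self X three_ne_zero).trans hc
  have key : g 0 0 * g 1 1 ≠ 0 := by
    intro h
    rw [h, zero_sub] at hdet
    have : (X : (ZMod 2)[X]) ∣ 1 := hdet ▸ (hXc.mul_left _).neg_right
    exact not_isUnit_X (isUnit_of_dvd_one this)
  exact ⟨left_ne_zero_of_mul key, right_ne_zero_of_mul key⟩

theorem factorNum_sub {g : Matrix (Fin 2) (Fin 2) (ZMod 2)[X]} (hg : g.det = 1) :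
    factorNum e ρ g - factorDenom₁ e ρ g * factorDenom₂ e ρ g =
      e (bitPoly 40) + e (bitPoly 24) * ρ := by
  have hdet := congrArg e hg
  rw [det_fin_two, map_sub, map_mul, map_mul, map_one] at hdet
  rw [show 40 = 2 ^ 5 ^^^ 2 ^ 3 by decide, show 24 = 2 ^ 4 ^^^ 2 ^ 3 by decide]
  simp only [factorNum, factorDenom₁, factorDenom₂, lowerPoly, bitPoly_xor, bitPoly_two_pow,
    map_add, map_mul, map_pow]
  linear_combination (e X ^ 4 + e X ^ 3) * ρ * hdet - e X ^ 2 * (e X ^ 3 + e X) * hdet -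
    (e X ^ 5 + e X ^ 3) * two_eq_zero e

variable [IsUltrametricDist C]

theorem norm_factorNum_sub (hX : ‖e X‖ = 2) (hρ : ρ ^ 2 + ρ + 1 = 0)
    {g : Matrix (Fin 2) (Fin 2) (ZMod 2)[X]} (hg : g.det = 1) :
    ‖factorNum e ρ g - factorDenom₁ e ρ g * factorDenom₂ e ρ g‖ = 32 := by
  rw [factorNum_sub hg, norm_add_mul_root hX hρ, norm_bitPoly hX (by norm_num),
    norm_bitPoly hX (by norm_num), show Nat.log2 40 = 5 by decide, show Nat.log2 24 = 4 by decide]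
  norm_num

theorem norm_factorDenom₁ (hX : ‖e X‖ = 2) (hρ : ρ ^ 2 + ρ + 1 = 0)
    (g : Matrix (Fin 2) (Fin 2) (ZMod 2)[X]) :
    ‖factorDenom₁ e ρ g‖ = max (‖e (g 1 1)‖ * 4) ‖e (g 1 0)‖ := by
  rw [factorDenom₁, norm_add_mul_root hX hρ, map_mul, map_pow, norm_mul, norm_pow, hX]
  norm_num

theorem norm_factorDenom₂ (hX : ‖e X‖ = 2) (hρ : ρ ^ 2 + ρ + 1 = 0)
    (g : Matrix (Fin 2) (Fin 2) (ZMod 2)[X]) :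
    ‖factorDenom₂ e ρ g‖ = max ‖e (lowerPoly (g 0 0) (g 0 1))‖ ‖e (g 0 0)‖ := by
  rw [factorDenom₂, norm_add_mul_root hX hρ]

theorem norm_mul_two_le_norm_factorDenom₂ (hX : ‖e X‖ = 2) (hρ : ρ ^ 2 + ρ + 1 = 0)
    (g : Matrix (Fin 2) (Fin 2) (ZMod 2)[X]) : ‖e (g 0 1)‖ * 2 ≤ ‖factorDenom₂ e ρ g‖ := by
  have hU : ‖e (X ^ 3 + X)‖ = 8 := by
    rw [← bitPoly_ten, norm_bitPoly hX (by norm_num), show Nat.log2 10 = 3 by decide]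
    norm_num
  have hN : ‖e (X ^ 4 + X ^ 3 + X ^ 2)‖ = 16 := by
    rw [← bitPoly_twentyEight, norm_bitPoly hX (by norm_num), show Nat.log2 28 = 4 by decide]
    norm_num
  have h : ‖e (g 0 1)‖ * 16 ≤ max ‖e (lowerPoly (g 0 0) (g 0 1))‖ (‖e (g 0 0)‖ * 8) := by
    rw [← hN, ← hU, ← norm_mul, ← norm_mul, ← map_mul, ← map_mul,
      show g 0 1 * (X ^ 4 + X ^ 3 + X ^ 2) = lowerPoly (g 0 0) (g 0 1) - g 0 0 * (X ^ 3 + X) by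
        rw [lowerPoly]; ring, map_sub, sub_eq_add_neg,
      ← norm_neg (e (g 0 0 * (X ^ 3 + X)))]
    exact IsUltrametricDist.norm_add_le_max _ _
  rw [norm_factorDenom₂ hX hρ]
  have h1 := le_max_left ‖e (lowerPoly (g 0 0) (g 0 1))‖ ‖e (g 0 0)‖
  have h2 := le_max_right ‖e (lowerPoly (g 0 0) (g 0 1))‖ ‖e (g 0 0)‖
  rcases le_max_iff.1 h with h | h <;> linarith [norm_nonneg (e (g 0 1)), norm_nonneg (e (g 0 0))]

theorem four_le_norm_factorDenom₁ (hX : ‖e X‖ = 2) (hρ : ρ ^ 2 + ρ + 1 = 0)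
    {g : Matrix (Fin 2) (Fin 2) (ZMod 2)[X]} (hg : g ∈ Gamma0T3) : 4 ≤ ‖factorDenom₁ e ρ g‖ := by
  rw [norm_factorDenom₁ hX hρ]
  exact le_max_of_le_left (by linarith [one_le_norm hX (ne_zero_of_mem_Gamma0T3 hg).2])

theorem one_le_norm_factorDenom₂ (hX : ‖e X‖ = 2) (hρ : ρ ^ 2 + ρ + 1 = 0)
    {g : Matrix (Fin 2) (Fin 2) (ZMod 2)[X]} (hg : g ∈ Gamma0T3) : 1 ≤ ‖factorDenom₂ e ρ g‖ := by
  rw [norm_factorDenom₂ hX hρ]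
  exact le_max_of_le_right (one_le_norm hX (ne_zero_of_mem_Gamma0T3 hg).1)

/-- The factor of `u_α(0)` attached to `g`. -/
noncomputable def factorAt (e : (ZMod 2)[X] →+* C) (ρ : C)
    (g : Matrix (Fin 2) (Fin 2) (ZMod 2)[X]) : C :=
  factorNum e ρ g / (factorDenom₁ e ρ g * factorDenom₂ e ρ g)

theorem norm_factor_sub_one (hX : ‖e X‖ = 2) (hρ : ρ ^ 2 + ρ + 1 = 0)
    {g : Matrix (Fin 2) (Fin 2) (ZMod 2)[X]} (hg : g ∈ Gamma0T3) :
    ‖factorAt e ρ g - 1‖ = 32 / (‖factorDenom₁ e ρ g‖ * ‖factorDenom₂ e ρ g‖) := by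
  have h1 : factorDenom₁ e ρ g ≠ 0 :=
    norm_pos_iff.1 (by linarith [four_le_norm_factorDenom₁ hX hρ hg])
  have h2 : factorDenom₂ e ρ g ≠ 0 :=
    norm_pos_iff.1 (by linarith [one_le_norm_factorDenom₂ hX hρ hg])
  rw [factorAt, div_sub_one (mul_ne_zero h1 h2), norm_div, norm_factorNum_sub hX hρ hg.1, norm_mul]

theorem finite_le_norm_factor_sub_one (hX : ‖e X‖ = 2) (hρ : ρ ^ 2 + ρ + 1 = 0) {ε : ℝ}
    (hε : 0 < ε) : {γ : Gamma0T3 | ε ≤ ‖factorAt e ρ γ.val - 1‖}.Finite := by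
  obtain ⟨k, hk⟩ := pow_unbounded_of_one_lt (32 / ε) one_lt_two
  have hfin : {g : Matrix (Fin 2) (Fin 2) (ZMod 2)[X] |
      ∀ i j, g i j ∈ bitPoly '' Set.Iio (2 ^ k)}.Finite :=
    Set.Finite.pi' fun _ => Set.Finite.pi' fun _ => (Set.finite_Iio _).image _
  refine (hfin.preimage Subtype.val_injective.injOn).subset ?_
  rintro ⟨g, hg⟩ hγ
  have hγ' : ε ≤ ‖factorAt e ρ g - 1‖ := hγ
  have h1 := four_le_norm_factorDenom₁ hX hρ hg
  have h2 := one_le_norm_factorDenom₂ hX hρ hg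
  have hb := norm_mul_two_le_norm_factorDenom₂ hX hρ g
  rw [norm_factor_sub_one hX hρ hg, le_div_iff₀ (by positivity), mul_comm, ← le_div_iff₀ hε] at hγ'
  have hD1 : ‖factorDenom₁ e ρ g‖ < 2 ^ k := by nlinarith
  have hD2 : ‖factorDenom₂ e ρ g‖ < 2 ^ k := by nlinarith
  have hsmall : ∀ p, ‖e p‖ < 2 ^ k → p ∈ bitPoly '' Set.Iio (2 ^ k) := by
    intro p hp
    obtain ⟨n, rfl⟩ := bitPoly_surjective p
    exact ⟨n, lt_two_pow_of_norm_bitPoly_lt hX hp, rfl⟩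
  have hd : ‖e (g 1 1)‖ * 4 ≤ ‖factorDenom₁ e ρ g‖ := by
    rw [norm_factorDenom₁ hX hρ]; exact le_max_left _ _
  have hc : ‖e (g 1 0)‖ ≤ ‖factorDenom₁ e ρ g‖ := by
    rw [norm_factorDenom₁ hX hρ]; exact le_max_right _ _
  have ha : ‖e (g 0 0)‖ ≤ ‖factorDenom₂ e ρ g‖ := by
    rw [norm_factorDenom₂ hX hρ]; exact le_max_right _ _
  have hnn : ∀ p, 0 ≤ ‖e p‖ := fun p => norm_nonneg _
  intro i j
  refine hsmall _ ?_
  fin_cases i <;> fin_cases j <;> dsimp only [Fin.zero_eta, Fin.mk_one]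
  · exact ha.trans_lt hD2
  · linarith [hnn (g 0 1)]
  · exact hc.trans_lt hD1
  · linarith [hnn (g 1 1)]

end Factor

set_option maxRecDepth 100000 in
theorem closeTest_boxProd : closeTest (boxProd numCode) (boxProd denCode) = true := by
  decide +kernel

section Box

attribute [irreducible] detOne solveDet lowerCode

/-- The number of codes of `c / T³` to be searched when the first row has codes
`2 * i + 1` and `b`. -/
def boxHeight (i b : ℕ) : ℕ := 128 / 2 ^ (max (2 * i + 1) (lowerCode (2 * i + 1) b)).log2

/-- The matrix of `Γ₀(T³)` with entries of codes `2 * i + 1`, `b`, `8 * j` if it exists with a small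
lower right entry, where `q = ⟨(i, b), j⟩`. -/
noncomputable def boxMatrix (q : Σ _ : ℕ × ℕ, ℕ) : Matrix (Fin 2) (Fin 2) (ZMod 2)[X] :=
  !![bitPoly (2 * q.1.1 + 1), bitPoly q.1.2;
    bitPoly (8 * q.2), bitPoly (solveDet (2 * q.1.1 + 1) q.1.2 (8 * q.2))]

/-- The codes of the matrices of determinant one in the search box. -/
@[irreducible] def box : Finset (Σ _ : ℕ × ℕ, ℕ) :=
  ((Finset.range 128 ×ˢ Finset.range 128).sigma fun p => Finset.range (boxHeight p.1 p.2)).filter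
    fun q => detOne (2 * q.1.1 + 1) q.1.2 (8 * q.2)
      (solveDet (2 * q.1.1 + 1) q.1.2 (8 * q.2)) = true

theorem quadEval_boxProd {C : Type*} [NormedField C] {e : (ZMod 2)[X] →+* C} {ρ : C}
    (hρ : ρ ^ 2 + ρ + 1 = 0) (t : ℕ → ℕ → ℕ → ℕ → ℕ × ℕ) :
    quadEval e ρ (boxProd t) = ∏ q ∈ box, quadEval e ρ (t (2 * q.1.1 + 1) q.1.2 (8 * q.2)
      (solveDet (2 * q.1.1 + 1) q.1.2 (8 * q.2))) := by
  unfold box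
  rw [Finset.prod_filter, Finset.prod_sigma, Finset.prod_product]
  simp only [boxProd, force_eq, quadEval_quadProd hρ]
  refine Finset.prod_congr rfl fun i _ => Finset.prod_congr rfl fun b _ =>
    Finset.prod_congr rfl fun j _ => ?_
  cases detOne (2 * i + 1) b (8 * j) (solveDet (2 * i + 1) b (8 * j)) <;> simp [quadEval]

theorem detOne_iff (a b c d : ℕ) :
    detOne a b c d = true ↔ bitPoly a * bitPoly d - bitPoly b * bitPoly c = 1 := by
  rw [detOne, Nat.beq_eq, ← bitPoly_injective.eq_iff, bitPoly_clmul, bitPoly_xor, bitPoly_clmul,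
    bitPoly_one, CharTwo.sub_eq_add, CharTwo.add_eq_iff_eq_add, add_comm]

theorem bitPoly_eight_mul (j : ℕ) : bitPoly (8 * j) = X ^ 3 * bitPoly j :=
  bitPoly_two_pow_mul 3 j

theorem bitPoly_four_mul (j : ℕ) : bitPoly (4 * j) = bitPoly j * X ^ 2 :=
  (bitPoly_two_pow_mul 2 j).trans (mul_comm _ _)

theorem boxMatrix_mem {q : Σ _ : ℕ × ℕ, ℕ} (hq : q ∈ box) : boxMatrix q ∈ Gamma0T3 := by
  unfold box at hq
  rw [Finset.mem_filter, detOne_iff] at hq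
  have h := hq.2
  refine ⟨?_, ?_⟩
  · simpa [boxMatrix, det_fin_two] using h
  · simp [boxMatrix, bitPoly_eight_mul]

theorem boxMatrix_injective : Function.Injective boxMatrix := by
  rintro ⟨⟨i, b⟩, j⟩ ⟨⟨i', b'⟩, j'⟩ h
  have h00 := bitPoly_injective (congrFun (congrFun h 0) 0)
  have h01 : b = b' := bitPoly_injective (congrFun (congrFun h 0) 1)
  have h10 := bitPoly_injective (congrFun (congrFun h 1) 0)
  dsimp only at h00 h10
  obtain rfl : i = i' := by omega
  obtain rfl : j = j' := by omega
  rw [h01]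

theorem solveDet_eq {i b c d : ℕ} (hd : d < 256)
    (h : bitPoly (2 * i + 1) * bitPoly d - bitPoly b * bitPoly c = 1) :
    solveDet (2 * i + 1) b c = d := by
  have ha : bitPoly (2 * i + 1) = 1 + X * bitPoly i := by
    rw [bitPoly_eq_mod_two_add, show (2 * i + 1) % 2 = 1 by omega,
      show (2 * i + 1) / 2 = i by omega, bitPoly_one]
  have ha8 : bitPoly (2 * i + 1) ^ 8 = 1 + X ^ 8 * bitPoly i ^ 8 := by
    rw [ha, show 8 = 2 ^ 3 by norm_num, add_pow_char_pow, one_pow, mul_pow]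
  rw [solveDet, force_eq]
  set r := clmul (clmul (1 ^^^ clmul b c) (2 * i + 1)) (clmul (clmul (2 * i + 1) (2 * i + 1))
    (clmul (clmul (2 * i + 1) (2 * i + 1)) (clmul (2 * i + 1) (2 * i + 1)))) with hr
  have hP : bitPoly r = bitPoly d + X ^ 8 * (bitPoly i ^ 8 * bitPoly d) := by
    have h1 : 1 + bitPoly b * bitPoly c = bitPoly (2 * i + 1) * bitPoly d := by
      rw [← h]; ring
    simp only [hr, bitPoly_clmul, bitPoly_xor, bitPoly_one, h1]
    linear_combination bitPoly d * ha8
  refine Nat.eq_of_testBit_eq fun k => ?_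
  rw [show 256 = 2 ^ 8 by norm_num, Nat.testBit_mod_two_pow]
  by_cases hk : k < 8
  · have := congrArg (fun p => coeff p k) hP
    simp only [coeff_add, coeff_X_pow_mul', if_neg (not_le.2 hk), add_zero, coeff_bitPoly] at this
    cases h1 : r.testBit k <;> cases h2 : d.testBit k <;> simp_all
  · rw [Nat.testBit_lt_two_pow (hd.trans_le (Nat.pow_le_pow_right two_pos (not_lt.1 hk)) : d < 2 ^ k)]
    simp [hk]

variable {C : Type*} [NormedField C] {e : (ZMod 2)[X] →+* C} {ρ : C}

theorem quadEval_numCode (hρ : ρ ^ 2 + ρ + 1 = 0) (q : Σ _ : ℕ × ℕ, ℕ) :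
    quadEval e ρ (numCode (2 * q.1.1 + 1) q.1.2 (8 * q.2)
      (solveDet (2 * q.1.1 + 1) q.1.2 (8 * q.2))) = factorNum e ρ (boxMatrix q) := by
  rw [numCode, quadEval_quadMul hρ]
  simp [factorNum, quadEval, boxMatrix, bitPoly_lowerCode, bitPoly_four_mul]

theorem quadEval_denCode (hρ : ρ ^ 2 + ρ + 1 = 0) (q : Σ _ : ℕ × ℕ, ℕ) :
    quadEval e ρ (denCode (2 * q.1.1 + 1) q.1.2 (8 * q.2)
      (solveDet (2 * q.1.1 + 1) q.1.2 (8 * q.2))) =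
      factorDenom₁ e ρ (boxMatrix q) * factorDenom₂ e ρ (boxMatrix q) := by
  rw [denCode, quadEval_quadMul hρ]
  simp [factorDenom₁, factorDenom₂, quadEval, boxMatrix, bitPoly_lowerCode, bitPoly_four_mul]

variable [IsUltrametricDist C]

theorem mem_image_boxMatrix (hX : ‖e X‖ = 2) (hρ : ρ ^ 2 + ρ + 1 = 0)
    {g : Matrix (Fin 2) (Fin 2) (ZMod 2)[X]} (hg : g ∈ Gamma0T3)
    (h : ‖factorDenom₁ e ρ g‖ * ‖factorDenom₂ e ρ g‖ < 1024) : g ∈ box.image boxMatrix := by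
  obtain ⟨ha0, hd0⟩ := ne_zero_of_mem_Gamma0T3 hg
  have h1 := four_le_norm_factorDenom₁ hX hρ hg
  have h2 := one_le_norm_factorDenom₂ hX hρ hg
  have hb := norm_mul_two_le_norm_factorDenom₂ hX hρ g
  have hd : ‖e (g 1 1)‖ * 4 ≤ ‖factorDenom₁ e ρ g‖ := by
    rw [norm_factorDenom₁ hX hρ]; exact le_max_left _ _
  have hc : ‖e (g 1 0)‖ ≤ ‖factorDenom₁ e ρ g‖ := by
    rw [norm_factorDenom₁ hX hρ]; exact le_max_right _ _
  have ha : ‖e (g 0 0)‖ ≤ ‖factorDenom₂ e ρ g‖ := by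
    rw [norm_factorDenom₂ hX hρ]; exact le_max_right _ _
  obtain ⟨hdet, c', hc'⟩ := hg
  rw [det_fin_two] at hdet
  obtain ⟨a, hga⟩ := bitPoly_surjective (g 0 0)
  obtain ⟨b, hgb⟩ := bitPoly_surjective (g 0 1)
  obtain ⟨d, hgd⟩ := bitPoly_surjective (g 1 1)
  obtain ⟨j, rfl⟩ := bitPoly_surjective c'
  rw [← bitPoly_eight_mul] at hc'
  have hodd : a % 2 = 1 := by
    by_contra hodd
    have hX0 := congrArg (fun p => coeff p 0) hdet
    simp [← hga, ← hgd, hc', bitPoly_eight_mul, mul_coeff_zero, coeff_bitPoly,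
      show a % 2 = 0 by omega] at hX0
  obtain ⟨i, rfl⟩ : ∃ i, a = 2 * i + 1 := ⟨a / 2, by omega⟩
  set w := lowerCode (2 * i + 1) b with hw
  have hD2 : ‖factorDenom₂ e ρ g‖ = 2 ^ (max (2 * i + 1) w).log2 := by
    rw [← norm_bitPoly hX (by omega), factorDenom₂, ← hga, ← hgb, ← bitPoly_lowerCode, ← hw,
      max_comm]
    exact norm_quadEval hX hρ (w, 2 * i + 1)
  set L := (max (2 * i + 1) w).log2 with hL
  have hL7 : L ≤ 7 := by
    have : (2 : ℝ) ^ L < 2 ^ 8 := by rw [← hD2]; nlinarith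
    have := (pow_lt_pow_iff_right₀ one_lt_two).1 this
    omega
  have hD2' : ‖factorDenom₂ e ρ g‖ < 2 ^ 8 := by nlinarith
  rw [← hga] at ha hdet
  rw [← hgb] at hb hdet
  rw [← hgd] at hd hdet
  rw [hc'] at hc hdet
  have hi : i < 128 := by
    have := lt_two_pow_of_norm_bitPoly_lt hX (ha.trans_lt hD2')
    omega
  have hb' : b < 128 := lt_two_pow_of_norm_bitPoly_lt hX (k := 7) (by linarith)
  have hd' : d < 256 := lt_two_pow_of_norm_bitPoly_lt hX (k := 8) (by nlinarith)
  have hj : j < boxHeight i b := by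
    rw [boxHeight, ← hw, ← hL, show 128 = 2 ^ 7 by norm_num, Nat.pow_div hL7 two_pos]
    refine lt_two_pow_of_norm_bitPoly_lt hX ?_
    have h8 : ‖e (bitPoly j)‖ * 8 ≤ ‖factorDenom₁ e ρ g‖ := by
      refine le_trans (le_of_eq ?_) hc
      rw [bitPoly_eight_mul, map_mul, norm_mul, map_pow, norm_pow, hX]
      ring
    have h7 : (2 : ℝ) ^ (7 - L) * 2 ^ L = 128 := by
      rw [← pow_add, Nat.sub_add_cancel hL7]; norm_num
    have hLpos : (0 : ℝ) < 2 ^ L := by positivity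
    rw [hD2] at h
    nlinarith
  have hs := solveDet_eq hd' hdet
  refine Finset.mem_image.2 ⟨⟨(i, b), j⟩, ?_, ?_⟩
  · unfold box
    rw [Finset.mem_filter]
    refine ⟨?_, ?_⟩
    · simp [hi, hb', hj]
    · dsimp only
      rw [hs, detOne_iff, hdet]
  · ext r s : 2
    fin_cases r <;> fin_cases s <;> simp [boxMatrix, hs, hga, hgb, hgd, hc']

theorem norm_prod_box (hX : ‖e X‖ = 2) (hρ : ρ ^ 2 + ρ + 1 = 0) :
    ‖∏ q ∈ box, factorAt e ρ (boxMatrix q) - (e X)⁻¹‖ ≤ 2⁻¹ ^ 6 := by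
  have hden : quadEval e ρ (boxProd denCode) ≠ 0 := by
    rw [quadEval_boxProd hρ, Finset.prod_ne_zero_iff]
    intro q hq h0
    have h := norm_factor_sub_one hX hρ (boxMatrix_mem hq)
    have h1 := four_le_norm_factorDenom₁ hX hρ (boxMatrix_mem hq)
    have h2 := one_le_norm_factorDenom₂ hX hρ (boxMatrix_mem hq)
    have h3 : factorDenom₁ e ρ (boxMatrix q) * factorDenom₂ e ρ (boxMatrix q) = 0 := by
      rw [← h0, quadEval_denCode hρ]
    rw [← norm_eq_zero, norm_mul] at h3
    nlinarith
  simp only [factorAt, ← quadEval_numCode hρ, ← quadEval_denCode hρ]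
  rw [Finset.prod_div_distrib, ← quadEval_boxProd hρ numCode, ← quadEval_boxProd hρ denCode]
  have htest := closeTest_boxProd
  generalize boxProd numCode = p at *
  generalize boxProd denCode = q at *
  have hX0 : e X ≠ 0 := norm_pos_iff.1 (by rw [hX]; norm_num)
  have hsub : quadEval e ρ p / quadEval e ρ q - (e X)⁻¹ =
      quadEval e ρ (2 * p.1 ^^^ q.1, 2 * p.2 ^^^ q.2) / (e X * quadEval e ρ q) := by
    have h2 : ∀ n, bitPoly (2 * n) = X * bitPoly n := fun n => by
      simpa using bitPoly_two_pow_mul 1 n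
    have h3 : quadEval e ρ (2 * p.1 ^^^ q.1, 2 * p.2 ^^^ q.2) =
        e X * quadEval e ρ p - quadEval e ρ q := by
      simp only [quadEval, bitPoly_xor, h2, map_add, map_mul]
      linear_combination (e (bitPoly q.1) + e (bitPoly q.2) * ρ) * two_eq_zero e
    rw [h3]
    field_simp
  have hlog := Nat.le_of_ble_eq_true htest
  have hq0 : max q.1 q.2 ≠ 0 := by
    intro h
    rw [← norm_ne_zero_iff, norm_quadEval hX hρ, h] at hden
    simp at hden
  rw [hsub, norm_div, norm_mul, hX, norm_quadEval hX hρ q, norm_quadEval hX hρ,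
    norm_bitPoly hX hq0, div_le_iff₀ (by positivity)]
  rcases eq_or_ne (max (2 * p.1 ^^^ q.1) (2 * p.2 ^^^ q.2)) 0 with h0 | h0
  · rw [h0, bitPoly_zero, map_zero, norm_zero]
    positivity
  · rw [norm_bitPoly hX h0]
    have := pow_le_pow_right₀ (one_le_two (α := ℝ)) hlog
    rw [pow_add] at this
    linarith

end Box

section Action

variable {C : Type*} [NormedField C] [Algebra (LaurentSeries (ZMod 2)) C]

theorem polyEmb2_X : polyEmb2 C X = algebraMap (LaurentSeries (ZMod 2)) C Tel2 := by
  simp [polyEmb2]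

theorem norm_polyEmb2_X
    (hext : ∀ x : LaurentSeries (ZMod 2), ‖algebraMap (LaurentSeries (ZMod 2)) C x‖ = absK2 x) :
    ‖polyEmb2 C X‖ = 2 := by
  rw [polyEmb2_X, hext, absK2, Tel2, if_neg (by simp), HahnSeries.order_single one_ne_zero]
  norm_num

theorem act2_div (g : Matrix (Fin 2) (Fin 2) (ZMod 2)[X]) {z w : C} (hw : w ≠ 0) :
    act2 g (z / w) = (polyEmb2 C (g 0 0) * z + polyEmb2 C (g 0 1) * w) /
      (polyEmb2 C (g 1 0) * z + polyEmb2 C (g 1 1) * w) := by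
  rw [act2, ← mul_div_mul_right _ _ hw, add_mul, add_mul, mul_assoc, mul_assoc,
    div_mul_cancel₀ _ hw]

variable [IsUltrametricDist C]

theorem act2_alpha2 (hX : ‖polyEmb2 C X‖ = 2) {ρ : C} (hρ : ρ ^ 2 + ρ + 1 = 0) :
    act2 alpha2 (ρ / polyEmb2 C X ^ 2) =
      (polyEmb2 C (X ^ 3 + X) + ρ) / polyEmb2 C (X ^ 4 + X ^ 3 + X ^ 2) := by
  have hX0 : polyEmb2 C X ≠ 0 := norm_pos_iff.1 (by rw [hX]; norm_num)
  have hN : polyEmb2 C (X ^ 4 + X ^ 3 + X ^ 2) ≠ 0 := by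
    rw [← bitPoly_twentyEight, ← norm_pos_iff, norm_bitPoly hX (by norm_num)]
    positivity
  have hj : polyEmb2 C (X ^ 3) * ρ + polyEmb2 C (1 + X) * polyEmb2 C X ^ 2 ≠ 0 := by
    rw [add_comm, ← map_pow, ← map_mul, ← norm_pos_iff, norm_add_mul_root hX hρ, map_pow, norm_pow,
      hX]
    exact lt_max_of_lt_right (by positivity)
  rw [act2_div _ (pow_ne_zero 2 hX0)]
  simp only [alpha2, of_apply, cons_val', cons_val_zero, cons_val_one, cons_val_fin_one]
  rw [div_eq_div_iff hj hN]
  simp only [map_add, map_pow, map_one]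
  set t := polyEmb2 C X
  linear_combination (-t ^ 3) * hρ + ρ * (t ^ 5 + t ^ 4 + t ^ 3) * two_eq_zero (polyEmb2 C)

theorem act2_ratio (hX : ‖polyEmb2 C X‖ = 2) {ρ : C} (hρ : ρ ^ 2 + ρ + 1 = 0)
    (g : Matrix (Fin 2) (Fin 2) (ZMod 2)[X]) :
    (0 - act2 g ((polyEmb2 C X)⁻¹ ^ 2 * ρ)) /
      (0 - act2 g (act2 alpha2 ((polyEmb2 C X)⁻¹ ^ 2 * ρ))) = factorAt (polyEmb2 C) ρ g := by
  have hX0 : polyEmb2 C X ≠ 0 := norm_pos_iff.1 (by rw [hX]; norm_num)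
  have hN : polyEmb2 C (X ^ 4 + X ^ 3 + X ^ 2) ≠ 0 := by
    rw [← bitPoly_twentyEight, ← norm_pos_iff, norm_bitPoly hX (by norm_num)]
    positivity
  rw [show (polyEmb2 C X)⁻¹ ^ 2 * ρ = ρ / polyEmb2 C X ^ 2 by rw [inv_pow, div_eq_inv_mul],
    act2_alpha2 hX hρ, act2_div _ (pow_ne_zero 2 hX0), act2_div _ hN, zero_sub, zero_sub,
    neg_div_neg_eq, div_div_div_eq, factorAt, factorNum, factorDenom₁, factorDenom₂, lowerPoly,
    lowerPoly]
  simp only [map_add, map_mul, map_pow]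
  congr 1 <;> ring

end Action

/-- **Part of Proposition 8.1.**  With `ω = T⁻²·ρ` (`ρ² + ρ + 1 = 0`), the family
`γ ↦ (0 - γω)/(0 - γ(αω)) = (γω)/(γ(αω))`, indexed by `γ ∈ Γ = Γ₀(T³)`, is
multipliable, and its product `u_α(0)` satisfies `|u_α(0) - π| < 2⁻⁵`, `π = 1/T`. -/
theorem u_alpha_at_zero {C : Type*} [NormedField C] [CompleteSpace C]
    [Algebra (LaurentSeries (ZMod 2)) C]
    (hna : ∀ x y : C, ‖x + y‖ ≤ max ‖x‖ ‖y‖)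
    (hext : ∀ x : LaurentSeries (ZMod 2), ‖algebraMap (LaurentSeries (ZMod 2)) C x‖ = absK2 x)
    (ρ : C) (hρ : ρ ^ 2 + ρ + 1 = 0)
    (ω : C) (hω : ω = (polyEmb2 C Polynomial.X) ⁻¹ ^ 2 * ρ) :
    Multipliable (fun γ : Gamma0T3 =>
      ((0 : C) - act2 γ.val ω) / ((0 : C) - act2 γ.val (act2 alpha2 ω))) ∧
    ‖(∏' γ : Gamma0T3, ((0 : C) - act2 γ.val ω) / ((0 : C) - act2 γ.val (act2 alpha2 ω)))
        - (polyEmb2 C Polynomial.X)⁻¹‖ < (2 : ℝ) ^ (-5 : ℤ) := by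
  have : IsUltrametricDist C :=
    IsUltrametricDist.isUltrametricDist_of_forall_norm_add_le_max_norm hna
  have hX := norm_polyEmb2_X hext
  subst hω
  simp only [act2_ratio hX hρ]
  have hmul : Multipliable fun γ : Gamma0T3 => factorAt (polyEmb2 C) ρ γ.val :=
    multipliable_of_finite_le_norm_sub_one fun ε hε => finite_le_norm_factor_sub_one hX hρ hε
  refine ⟨hmul, ?_⟩
  have hout : ∀ γ ∉ (box.image boxMatrix).subtype (· ∈ Gamma0T3),
      ‖factorAt (polyEmb2 C) ρ γ.val - 1‖ ≤ 2⁻¹ ^ 5 := by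
    rintro ⟨g, hg⟩ hγ
    have h1 := four_le_norm_factorDenom₁ hX hρ hg
    have h2 := one_le_norm_factorDenom₂ hX hρ hg
    have h := not_lt.1 fun hlt => hγ (Finset.mem_subtype.2 (mem_image_boxMatrix hX hρ hg hlt))
    rw [norm_factor_sub_one hX hρ hg, div_le_iff₀ (by positivity)]
    linarith
  have hprod : ∏ γ ∈ (box.image boxMatrix).subtype (· ∈ Gamma0T3),
      factorAt (polyEmb2 C) ρ γ.val = ∏ q ∈ box, factorAt (polyEmb2 C) ρ (boxMatrix q) := by
    rw [Finset.prod_subtype_of_mem (f := factorAt (polyEmb2 C) ρ), Finset.prod_image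
      boxMatrix_injective.injOn]
    intro g hg
    obtain ⟨q, hq, rfl⟩ := Finset.mem_image.1 hg
    exact boxMatrix_mem hq
  have hlim := norm_tprod_sub_prod_le hmul (by norm_num) (by norm_num) _ hout
  rw [hprod] at hlim
  have hbox := norm_prod_box hX hρ
  set F := ∏ q ∈ box, factorAt (polyEmb2 C) ρ (boxMatrix q)
  have hF : ‖F‖ ≤ 2⁻¹ := by
    have h := IsUltrametricDist.norm_add_le_max (F - (polyEmb2 C X)⁻¹) (polyEmb2 C X)⁻¹
    rw [sub_add_cancel, norm_inv, hX] at h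
    exact h.trans (max_le (hbox.trans (by norm_num)) le_rfl)
  rw [← sub_add_sub_cancel _ F]
  refine (IsUltrametricDist.norm_add_le_max _ _).trans_lt (max_lt ?_ ?_)
  · refine hlim.trans_lt ?_
    norm_num
    linarith
  · exact hbox.trans_lt (by norm_num)
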